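/- Let (N,v,H) be a hypergraph communication situation with uniform hyperlink game (U(H),w) and let e∈H. Then any two players l,l'∈U(H)(e) are symmetric in (U(H),w) (i.e., w(S∪{l})=w(S∪{l'}) for all S⊆U(H)\{l,l'}), and consequently Sh_l(U(H),w) = (1/η(H))·Sh_e(H,v^N) for every l∈U(H)(e). -/

import Mathlib

open scoped Classical
open Finset

noncomputable section

namespace HGGame

/-! ## Generic hypergraph notions -/

variable {α : Type*}

/-- Two nodes are linked if they lie in a common hyperlink of `E`. -/
def Linked (E : Finset (Finset α)) (a b : α) : Prop :=
  ∃ e ∈ E, a ∈ e ∧ b ∈ e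

/-- The component of `i` in the subhypergraph of `(α, E)` induced by the ground set `S`
(only hyperlinks contained in `S` count). -/
def compOf (E : Finset (Finset α)) (S : Finset α) (i : α) : Finset α :=
  S.filter (fun j => Relation.ReflTransGen (Linked (E.filter (fun e => e ⊆ S))) i j)

/-- The set `S/E` of components of the subhypergraph induced by `S`. -/
def components (E : Finset (Finset α)) (S : Finset α) : Finset (Finset α) :=
  S.image (compOf E S)

/-- The hypergraph-restricted worth `v^E(S) = Σ_{T ∈ S/E} v(T)`. -/
def restrictedWorth (v : Finset α → ℝ) (E : Finset (Finset α)) (S : Finset α) : ℝ :=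
  ∑ T ∈ components E S, v T

/-! ## Shapley value -/

/-- The set `σ^i` of players preceding `i` in the ordering `σ`. -/
def preceding {M : Type*} [Fintype M] (σ : M ≃ Fin (Fintype.card M)) (i : M) : Finset M :=
  Finset.univ.filter (fun j => σ j < σ i)

/-- The marginal contribution `m^σ_i(u) = u(σ^i ∪ {i}) - u(σ^i)`. -/
def marginal {M : Type*} [Fintype M] (u : Finset M → ℝ) (σ : M ≃ Fin (Fintype.card M))
    (i : M) : ℝ :=
  u (insert i (preceding σ i)) - u (preceding σ i)

/-- The Shapley value of the TU-game `(M, u)`. -/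
def shapley {M : Type*} [Fintype M] (u : Finset M → ℝ) (i : M) : ℝ :=
  ((Fintype.card M).factorial : ℝ)⁻¹ * ∑ σ : M ≃ Fin (Fintype.card M), marginal u σ i

/-- The Harsanyi dividend `λ_T(u) = Σ_{∅ ≠ S ⊆ T} (-1)^{|T|-|S|} u(S)`. -/
def dividend {M : Type*} (u : Finset M → ℝ) (T : Finset M) : ℝ :=
  ∑ S ∈ T.powerset.filter (fun S => S ≠ ∅), (-1 : ℝ) ^ (T.card - S.card) * u S

/-! ## Hypergraph communication situations -/

variable {N : Type*} [Fintype N] [DecidableEq N]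

/-- The conference game `(H, v^N)`, a TU-game with player set `H`:
`v^N(H') = Σ_{T ∈ N/H'} v(T)`. -/
def confGame (v : Finset N → ℝ) (H : Finset (Finset N)) (F : Finset {e // e ∈ H}) : ℝ :=
  restrictedWorth v (F.image Subtype.val) Finset.univ

/-- The position value `π_i(N,v,H) = Σ_{e ∈ H_i} (1/|e|) · Sh_e(H, v^N)`. -/
def positionValue (v : Finset N → ℝ) (H : Finset (Finset N)) (i : N) : ℝ :=
  ∑ e ∈ H.attach.filter (fun e => i ∈ e.val),
    ((e.val.card : ℝ))⁻¹ * shapley (confGame v H) e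

/-! ## The uniform hyperlink game -/

/-- The type of agents `(i, e, k)` of the uniform hyperlink game. -/
abbrev UElem (N : Type*) := N × Finset N × ℕ

/-- `η(H)`: the least common multiple of the hyperlink sizes. -/
def eta (H : Finset (Finset N)) : ℕ := H.lcm Finset.card

/-- `U(H)(i,e) = {(i,e,k) : k = 1, …, η(H)/|e|}`. -/
def UHie (H : Finset (Finset N)) (i : N) (e : Finset N) : Finset (UElem N) :=
  (Finset.Icc 1 (eta H / e.card)).image fun k => (i, e, k)

/-- `U(H)(i) = ∪_{e ∈ H_i} U(H)(i,e)`. -/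
def UHi (H : Finset (Finset N)) (i : N) : Finset (UElem N) :=
  (H.filter (fun e => i ∈ e)).biUnion fun e => UHie H i e

/-- `U(H)(e) = ∪_{i ∈ e} U(H)(i,e)`. -/
def UHe (H : Finset (Finset N)) (e : Finset N) : Finset (UElem N) :=
  e.biUnion fun i => UHie H i e

/-- `U(H) = ∪_{i ∈ N} U(H)(i)`. -/
def UH (H : Finset (Finset N)) : Finset (UElem N) :=
  Finset.univ.biUnion fun i : N => UHi H i

/-- `H[S] = {e ∈ H : U(H)(e) ⊆ S}`. -/
def Hof (H : Finset (Finset N)) (S : Finset (UElem N)) : Finset (Finset N) :=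
  H.filter fun e => UHe H e ⊆ S

/-- The characteristic function `w(S) = Σ_{R ∈ N/H[S]} v(R)` of the uniform hyperlink game. -/
def uw (v : Finset N → ℝ) (H : Finset (Finset N)) (S : Finset (UElem N)) : ℝ :=
  restrictedWorth v (Hof H S) Finset.univ

/-- The uniform hyperlink game `(U(H), w)` as a TU-game with player set `U(H)`. -/
def uGame (v : Finset N → ℝ) (H : Finset (Finset N)) (F : Finset {l // l ∈ UH H}) : ℝ :=
  uw v H (F.image Subtype.val)

/-! ## Unanimity games -/

/-- The unanimity game `u_T`: a coalition is worth `1` if it contains `T` and `0` otherwise. -/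
def unanimity {M : Type*} (T S : Finset M) : ℝ := if T ⊆ S then 1 else 0

/-- Every set function is a linear combination of unanimity games. -/
lemma exists_eq_sum_unanimity {M : Type*} [Fintype M] (u : Finset M → ℝ) :
    ∃ a : Finset M → ℝ, u = fun S => ∑ T, a T * unanimity T S := by
  let L : (Finset M → ℝ) →ₗ[ℝ] (Finset M → ℝ) :=
    { toFun := fun a S => ∑ T, a T * unanimity T S
      map_add' := fun a b => by
        funext S
        simp [add_mul, Finset.sum_add_distrib]
      map_smul' := fun r a => by
        funext S
        simp [Finset.mul_sum, mul_assoc] }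
  have hinj : Function.Injective L := by
    rw [injective_iff_map_eq_zero]
    intro a ha
    funext S
    induction S using Finset.strongInduction with
    | H S ih =>
      have h : ∑ T, a T * unanimity T S = 0 := congrFun ha S
      rw [Finset.sum_eq_single S] at h
      · simpa [unanimity] using h
      · intro T _ hT
        by_cases hTS : T ⊆ S
        · rw [ih T (hTS.ssubset_of_ne hT)]
          simp
        · simp [unanimity, hTS]
      · simp
  obtain ⟨a, ha⟩ := LinearMap.surjective_of_injective hinj u
  exact ⟨a, ha.symm⟩

lemma shapley_sum_mul {M ι : Type*} [Fintype M] [Fintype ι] (a : ι → ℝ)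
    (u : ι → Finset M → ℝ) (i : M) :
    shapley (fun S => ∑ t, a t * u t S) i = ∑ t, a t * shapley (u t) i := by
  simp only [shapley, marginal, ← Finset.sum_sub_distrib, ← mul_sub]
  rw [Finset.sum_comm, Finset.mul_sum]
  refine Finset.sum_congr rfl fun t _ => ?_
  rw [← Finset.mul_sum]
  ring

lemma marginal_unanimity {M : Type*} [Fintype M] (T : Finset M)
    (σ : M ≃ Fin (Fintype.card M)) (i : M) :
    marginal (unanimity T) σ i = if i ∈ T ∧ ∀ j ∈ T, σ j ≤ σ i then 1 else 0 := by
  have hins : T ⊆ insert i (preceding σ i) ↔ ∀ j ∈ T, σ j ≤ σ i := by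
    refine forall₂_congr fun j _ => ?_
    simp [preceding, le_iff_eq_or_lt]
  have hpre : T ⊆ preceding σ i ↔ i ∉ T ∧ ∀ j ∈ T, σ j ≤ σ i := by
    constructor
    · intro h
      refine ⟨fun hi => by simpa [preceding] using h hi, fun j hj => ?_⟩
      have := h hj
      simp only [preceding, Finset.mem_filter] at this
      exact this.2.le
    · rintro ⟨hi, h⟩ j hj
      have hne : σ j ≠ σ i := fun h' => hi (σ.injective h' ▸ hj)
      simpa [preceding] using lt_of_le_of_ne (h j hj) hne
  simp only [marginal, unanimity, hins, hpre]
  by_cases hi : i ∈ T <;> by_cases h : ∀ j ∈ T, σ j ≤ σ i <;> simp [hi, h]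

lemma sum_marginal_unanimity {M : Type*} [Fintype M] {T : Finset M} (hT : T.Nonempty)
    (σ : M ≃ Fin (Fintype.card M)) : ∑ i ∈ T, marginal (unanimity T) σ i = 1 := by
  obtain ⟨m, hm, hmax⟩ := T.exists_max_image σ hT
  rw [Finset.sum_eq_single_of_mem m hm]
  · rw [marginal_unanimity, if_pos ⟨hm, hmax⟩]
  · intro j hj hne
    rw [marginal_unanimity, if_neg]
    rintro ⟨-, h⟩
    exact hne (σ.injective (le_antisymm (hmax j hj) (h m hm)))

lemma sum_marginal_unanimity_eq {M : Type*} [Fintype M] {T : Finset M} {i j : M}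
    (hi : i ∈ T) (hj : j ∈ T) :
    ∑ σ, marginal (unanimity T) σ i = ∑ σ, marginal (unanimity T) σ j := by
  have hmem : ∀ k ∈ T, Equiv.swap i j k ∈ T := by
    intro k hk
    rw [Equiv.swap_apply_def]
    split_ifs <;> assumption
  refine Fintype.sum_equiv ((Equiv.swap i j).equivCongr (Equiv.refl _)) _ _ fun σ => ?_
  rw [marginal_unanimity, marginal_unanimity]
  refine if_congr ?_ rfl rfl
  simp only [hi, hj, true_and, Equiv.equivCongr_apply_apply, Equiv.symm_swap,
    Equiv.swap_apply_right, Equiv.refl_apply]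
  refine ⟨fun h k hk => h _ (hmem k hk), fun h k hk => ?_⟩
  simpa using h _ (hmem k hk)

lemma shapley_unanimity {M : Type*} [Fintype M] (T : Finset M) (i : M) :
    shapley (unanimity T) i = if i ∈ T then (T.card : ℝ)⁻¹ else 0 := by
  split_ifs with hi
  · have hsum : ∑ j ∈ T, ∑ σ, marginal (unanimity T) σ j
        = ((Fintype.card M).factorial : ℝ) := by
      rw [Finset.sum_comm]
      simp [sum_marginal_unanimity ⟨i, hi⟩, Fintype.card_equiv (Fintype.equivFin M)]
    rw [Finset.sum_congr rfl fun j hj => sum_marginal_unanimity_eq hj hi,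
      Finset.sum_const, nsmul_eq_mul] at hsum
    have hcard : (T.card : ℝ) ≠ 0 := by
      exact_mod_cast (Finset.card_pos.mpr ⟨i, hi⟩).ne'
    have hfac : ((Fintype.card M).factorial : ℝ) ≠ 0 := by
      exact_mod_cast Nat.factorial_ne_zero _
    rw [shapley, ← hsum]
    rw [← hsum] at hfac
    have := right_ne_zero_of_mul hfac
    field_simp
  · simp [shapley, marginal_unanimity, hi]

/-- If every player `k` of a game `(K, c)` is replaced by `m` agents that act for `k` only when
they are all present, then each agent receives the share `1/m` of the Shapley value of `k`. -/
lemma shapley_of_fiber_replication {U K : Type*} [Fintype U] [Fintype K] (f : U → K) (m : ℕ)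
    (hf : ∀ k, (Finset.univ.filter fun l => f l = k).card = m) (c : Finset K → ℝ) (l : U) :
    shapley (fun S => c (Finset.univ.filter fun k => ∀ x, f x = k → x ∈ S)) l
      = (m : ℝ)⁻¹ * shapley c (f l) := by
  obtain ⟨a, rfl⟩ := exists_eq_sum_unanimity c
  have hpre : ∀ (T : Finset K) (S : Finset U),
      unanimity T (Finset.univ.filter fun k => ∀ x, f x = k → x ∈ S)
        = unanimity (Finset.univ.filter fun x => f x ∈ T) S := by
    intro T S
    refine if_congr ⟨fun h x hx => ?_, fun h k hk => ?_⟩ rfl rfl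
    · exact (Finset.mem_filter.mp (h (Finset.mem_filter.mp hx).2)).2 x rfl
    · simp only [Finset.mem_filter, Finset.mem_univ, true_and]
      rintro x rfl
      exact h (by simpa using hk)
  have hcard : ∀ T : Finset K, (Finset.univ.filter fun x => f x ∈ T).card = T.card * m := by
    intro T
    rw [Finset.card_eq_sum_card_fiberwise (f := f) (t := T) (by intro x hx; simpa using hx)]
    refine Finset.sum_const_nat fun k hk => ?_
    rw [← hf k, Finset.filter_filter]
    congr 1
    ext x
    simp only [Finset.mem_filter, Finset.mem_univ, true_and, and_iff_right_iff_imp]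
    rintro rfl
    exact hk
  simp only [hpre]
  rw [shapley_sum_mul, shapley_sum_mul, Finset.mul_sum]
  refine Finset.sum_congr rfl fun T _ => ?_
  rw [shapley_unanimity, shapley_unanimity, hcard]
  simp only [Finset.mem_filter, Finset.mem_univ, true_and]
  split_ifs
  · push_cast
    rw [mul_inv]
    ring
  · simp

/-! ## Agents of the uniform hyperlink game -/

lemma mem_UHie {N : Type*} [DecidableEq N] {H : Finset (Finset N)}
    {i : N} {e : Finset N} {l : UElem N} :
    l ∈ UHie H i e ↔ l.1 = i ∧ l.2.1 = e ∧ 1 ≤ l.2.2 ∧ l.2.2 ≤ eta H / e.card := by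
  obtain ⟨j, d, k⟩ := l
  simp only [UHie, Finset.mem_image, Finset.mem_Icc, Prod.mk.injEq]
  constructor
  · rintro ⟨k, hk, rfl, rfl, rfl⟩
    exact ⟨rfl, rfl, hk⟩
  · rintro ⟨rfl, rfl, hk⟩
    exact ⟨k, hk, rfl, rfl, rfl⟩

lemma mem_UHe {N : Type*} [DecidableEq N] {H : Finset (Finset N)} {e : Finset N} {l : UElem N} :
    l ∈ UHe H e ↔ l.2.1 = e ∧ l.1 ∈ e ∧ 1 ≤ l.2.2 ∧ l.2.2 ≤ eta H / e.card := by
  simp only [UHe, Finset.mem_biUnion, mem_UHie]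
  constructor
  · rintro ⟨i, hi, rfl, h, hk⟩
    exact ⟨h, hi, hk⟩
  · rintro ⟨h, hi, hk⟩
    exact ⟨_, hi, rfl, h, hk⟩

lemma mem_UH {H : Finset (Finset N)} {l : UElem N} :
    l ∈ UH H ↔ l.2.1 ∈ H ∧ l ∈ UHe H l.2.1 := by
  simp only [UH, UHi, Finset.mem_biUnion, Finset.mem_univ, true_and, Finset.mem_filter,
    mem_UHie, mem_UHe]
  constructor
  · rintro ⟨i, e, ⟨he, hi⟩, rfl, rfl, hk⟩
    exact ⟨he, hi, hk⟩
  · rintro ⟨he, hi, hk⟩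
    exact ⟨_, _, ⟨he, hi⟩, rfl, rfl, hk⟩

lemma card_UHe {N : Type*} [DecidableEq N] {H : Finset (Finset N)} {e : Finset N} (he : e ∈ H) :
    (UHe H e).card = eta H := by
  have h : UHe H e = (e ×ˢ Finset.Icc 1 (eta H / e.card)).image fun p => (p.1, e, p.2) := by
    ext ⟨i, d, k⟩
    simp only [mem_UHe, Finset.mem_image, Finset.mem_product, Finset.mem_Icc, Prod.exists,
      Prod.mk.injEq]
    constructor
    · rintro ⟨rfl, hi, hk⟩
      exact ⟨i, k, ⟨hi, hk⟩, rfl, rfl, rfl⟩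
    · rintro ⟨i, k, ⟨hi, hk⟩, rfl, rfl, rfl⟩
      exact ⟨rfl, hi, hk⟩
  rw [h, Finset.card_image_of_injective, Finset.card_product, Nat.card_Icc,
    Nat.add_sub_cancel]
  · exact Nat.mul_div_cancel' (Finset.dvd_lcm he)
  · rintro ⟨i, k⟩ ⟨j, m⟩ h
    simp only [Prod.mk.injEq] at h
    exact Prod.ext h.1 h.2.2

lemma Hof_insert_subset {N : Type*} [DecidableEq N] {H : Finset (Finset N)}
    {e : Finset N} {l l' : UElem N}
    (hl : l ∈ UHe H e) (hl' : l' ∈ UHe H e) (hne : l' ≠ l) {S : Finset (UElem N)}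
    (hS : l' ∉ S) : Hof H (insert l S) ⊆ Hof H (insert l' S) := by
  intro d hd
  simp only [Hof, Finset.mem_filter] at hd ⊢
  refine ⟨hd.1, fun x hx => Finset.mem_insert_of_mem ?_⟩
  rcases Finset.mem_insert.mp (hd.2 hx) with rfl | hxS
  · obtain rfl : d = e := (mem_UHe.mp hx).1.symm.trans (mem_UHe.mp hl).1
    rcases Finset.mem_insert.mp (hd.2 hl') with h | h
    · exact absurd h hne
    · exact absurd h hS
  · exact hxS

/-- The hyperlink represented by an agent. -/
def hyperlinkOf {H : Finset (Finset N)} (l : {x // x ∈ UH H}) : {e // e ∈ H} :=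
  ⟨l.val.2.1, (mem_UH.mp l.property).1⟩

lemma mem_UHe_iff_hyperlinkOf_eq {H : Finset (Finset N)} (l : {x // x ∈ UH H})
    (e : {e // e ∈ H}) : l.val ∈ UHe H e.val ↔ hyperlinkOf l = e := by
  refine ⟨fun h => Subtype.ext (mem_UHe.mp h).1, ?_⟩
  rintro rfl
  exact (mem_UH.mp l.property).2

lemma mem_UH_of_mem_UHe {H : Finset (Finset N)} {e : Finset N} (he : e ∈ H) {l : UElem N}
    (hl : l ∈ UHe H e) : l ∈ UH H := by
  obtain rfl := (mem_UHe.mp hl).1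
  exact mem_UH.mpr ⟨he, hl⟩

lemma card_filter_hyperlinkOf {H : Finset (Finset N)} (e : {e // e ∈ H}) :
    (Finset.univ.filter fun l : {x // x ∈ UH H} => hyperlinkOf l = e).card = eta H := by
  rw [← card_UHe e.property]
  refine Finset.card_bij (fun l _ => l.val) (fun l hl => ?_)
    (fun _ _ _ _ h => Subtype.ext h) fun x hx => ?_
  · exact (mem_UHe_iff_hyperlinkOf_eq l e).mpr (Finset.mem_filter.mp hl).2
  · exact ⟨⟨x, mem_UH_of_mem_UHe e.property hx⟩,
      by simpa using (mem_UHe_iff_hyperlinkOf_eq ⟨x, _⟩ e).mp hx, rfl⟩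

lemma uGame_eq_confGame (v : Finset N → ℝ) (H : Finset (Finset N)) :
    uGame v H = fun F => confGame v H
      (Finset.univ.filter fun e => ∀ l, hyperlinkOf l = e → l ∈ F) := by
  funext F
  unfold uGame uw confGame
  congr 1
  ext e
  simp only [Hof, Finset.mem_filter, Finset.mem_image, Finset.mem_univ, true_and]
  constructor
  · rintro ⟨he, h⟩
    refine ⟨⟨e, he⟩, fun l hl => ?_, rfl⟩
    obtain ⟨x, hx, hxl⟩ := Finset.mem_image.mp (h ((mem_UHe_iff_hyperlinkOf_eq l ⟨e, he⟩).mpr hl))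
    exact Subtype.ext hxl ▸ hx
  · rintro ⟨e, h, rfl⟩
    refine ⟨e.property, fun x hx => Finset.mem_image.mpr ?_⟩
    exact ⟨⟨x, mem_UH_of_mem_UHe e.property hx⟩,
      h _ ((mem_UHe_iff_hyperlinkOf_eq ⟨x, _⟩ e).mp hx), rfl⟩

/-- Any two agents of `U(H)(e)` are symmetric in the uniform hyperlink game, and
each receives `(1/η(H))·Sh_e(H, v^N)`. -/
theorem uniform_hyperlink_symmetric_players
    {N : Type*} [Fintype N] [DecidableEq N]
    (v : Finset N → ℝ) (H : Finset (Finset N))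
    (hN : 2 ≤ Fintype.card N)
    (hv0 : v ∅ = 0) (hzn : ∀ i : N, v {i} = 0)
    (hH : ∀ e ∈ H, 1 < e.card)
    (e : Finset N) (he : e ∈ H) :
    (∀ l l' : UElem N, l ∈ UHe H e → l' ∈ UHe H e →
        ∀ S ⊆ UH H \ {l, l'}, uw v H (insert l S) = uw v H (insert l' S))
    ∧ ∀ l : {x // x ∈ UH H}, l.val ∈ UHe H e →
        shapley (uGame v H) l = (eta H : ℝ)⁻¹ * shapley (confGame v H) ⟨e, he⟩ := by
  refine ⟨fun l l' hl hl' S hS => ?_, fun l hl => ?_⟩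
  · rcases eq_or_ne l l' with rfl | hne
    · rfl
    have hlS : l ∉ S := fun h => by simpa using hS h
    have hlS' : l' ∉ S := fun h => by simpa using hS h
    unfold uw
    congr 1
    exact (Hof_insert_subset hl hl' hne.symm hlS').antisymm (Hof_insert_subset hl' hl hne hlS)
  · rw [← (mem_UHe_iff_hyperlinkOf_eq l ⟨e, he⟩).mp hl, uGame_eq_confGame]
    convert shapley_of_fiber_replication hyperlinkOf (eta H) (fun k => ?_) (confGame v H) l
    convert card_filter_hyperlinkOf k

end HGGame
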